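/- Let Γ = ⟨S | R⟩ be a finitely presented group and let 𝒞 be a family of groups with bi-invariant metrics such that each (G, d) ∈ 𝒞 is a complete metric space. Then Γ has the property of defect diminishing with respect to 𝒞 if and only if D ⪯ id, where id(δ) = δ. -/

import Mathlib

/-- A group equipped with a bi-invariant metric. -/
structure MetricGroup where
  carrier : Type
  [group : Group carrier]
  [metric : MetricSpace carrier]
  dist_left_invariant : ∀ g x y : carrier, dist (g * x) (g * y) = dist x y
  dist_right_invariant : ∀ g x y : carrier, dist (x * g) (y * g) = dist x y

attribute [instance] MetricGroup.group MetricGroup.metric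

/-- defect(φ) = max_{r ∈ R} d(φ(r), 1), where φ also denotes the induced
homomorphism F(S) → G. -/
noncomputable def defect {S : Type} [Fintype S] (R : Finset (FreeGroup S)) {G : MetricGroup}
    (φ : S → G.carrier) : ℝ :=
  ((R.sup fun r => nndist ((FreeGroup.lift φ) r) 1 : NNReal) : ℝ)

/-- dist(φ, ψ) = max_{s ∈ S} d(φ(s), ψ(s)). -/
noncomputable def mapDist {S : Type} [Fintype S] {G : MetricGroup} (φ ψ : S → G.carrier) : ℝ :=
  ((Finset.univ.sup fun s => nndist (φ s) (ψ s) : NNReal) : ℝ)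

/-- HomDist(φ) = inf over homomorphisms π : Γ → G of dist(φ, (π ∘ q)|_S),
where Γ = F(S)/⟨⟨R⟩⟩ and q is the quotient map. -/
noncomputable def homDist {S : Type} [Fintype S] (R : Finset (FreeGroup S)) {G : MetricGroup}
    (φ : S → G.carrier) : ℝ :=
  ⨅ π : (FreeGroup S ⧸ Subgroup.normalClosure (R : Set (FreeGroup S))) →* G.carrier,
    mapDist φ (fun s => π ((QuotientGroup.mk' _) (FreeGroup.of s)))

/-- D(δ) = sup { HomDist(φ) : φ : S → G, G ∈ 𝒞, defect(φ) < δ }, valued in [0, ∞]. -/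
noncomputable def Drate {S : Type} [Fintype S] (𝒞 : Set MetricGroup)
    (R : Finset (FreeGroup S)) (δ : ℝ) : ENNReal :=
  ⨆ (G : MetricGroup) (_ : G ∈ 𝒞) (φ : S → G.carrier) (_ : defect R φ < δ),
    ENNReal.ofReal (homDist R φ)

/-- A sequence of maps φₙ : S → Gₙ is an asymptotic homomorphism if
lim_{n→𝒰} defect(φₙ) = 0. -/
def IsAsymptoticHom {S : Type} [Fintype S] (𝒰 : Ultrafilter ℕ) (R : Finset (FreeGroup S))
    (G : ℕ → MetricGroup) (φ : ∀ n, S → (G n).carrier) : Prop :=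
  Filter.Tendsto (fun n => defect R (φ n)) (𝒰 : Filter ℕ) (nhds 0)

/-- φ' diminishes the defect of φ: (a) dist(φₙ, φ'ₙ) = O_𝒰(defect(φₙ)) and
(b) defect(φ'ₙ) = o_𝒰(defect(φₙ)). -/
def Diminishes {S : Type} [Fintype S] (𝒰 : Ultrafilter ℕ) (R : Finset (FreeGroup S))
    (G : ℕ → MetricGroup) (φ φ' : ∀ n, S → (G n).carrier) : Prop :=
  (∃ C : ℝ, 0 < C ∧ {n | mapDist (φ n) (φ' n) ≤ C * defect R (φ n)} ∈ 𝒰) ∧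
  (∃ ε : ℕ → ℝ, (∀ n, 0 ≤ ε n) ∧ Filter.Tendsto ε (𝒰 : Filter ℕ) (nhds 0) ∧
     ∀ n, defect R (φ' n) = ε n * defect R (φ n))

/-- The property of defect diminishing for the presentation ⟨S | R⟩ with respect to
the class 𝒞: every asymptotic homomorphism admits a sequence diminishing its defect. -/
def DefectDiminishing {S : Type} [Fintype S] (𝒰 : Ultrafilter ℕ) (𝒞 : Set MetricGroup)
    (R : Finset (FreeGroup S)) : Prop :=
  ∀ G : ℕ → MetricGroup, (∀ n, G n ∈ 𝒞) →
    ∀ φ : ∀ n, S → (G n).carrier, IsAsymptoticHom 𝒰 R G φ →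
      ∃ φ' : ∀ n, S → (G n).carrier, Diminishes 𝒰 R G φ φ'

lemma mapDist_eq_dist {S : Type} [Fintype S] {G : MetricGroup} (φ ψ : S → G.carrier) :
    mapDist φ ψ = dist φ ψ := rfl

lemma defect_nonneg' {S : Type} [Fintype S] (R : Finset (FreeGroup S)) {G : MetricGroup}
    (φ : S → G.carrier) : 0 ≤ defect R φ := NNReal.coe_nonneg _

lemma dist_le_defect {S : Type} [Fintype S] (R : Finset (FreeGroup S)) {G : MetricGroup}
    (φ : S → G.carrier) {r : FreeGroup S} (hr : r ∈ R) :
    dist (FreeGroup.lift φ r) 1 ≤ defect R φ := by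
  have := Finset.le_sup (f := fun r => nndist ((FreeGroup.lift φ) r) 1) hr
  exact_mod_cast this

lemma defect_eq_zero {S : Type} [Fintype S] (R : Finset (FreeGroup S)) {G : MetricGroup}
    (φ : S → G.carrier) (h : ∀ r ∈ R, FreeGroup.lift φ r = 1) : defect R φ = 0 := by
  unfold defect
  rw [NNReal.coe_eq_zero, ← bot_eq_zero, Finset.sup_eq_bot_iff]
  intro r hr
  simp [h r hr]

lemma dist_inv_inv' {G : MetricGroup} (x y : G.carrier) : dist x⁻¹ y⁻¹ = dist x y := by
  rw [← G.dist_left_invariant x, ← G.dist_right_invariant y]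
  simp [dist_comm]

lemma dist_mul_mul_le'' {G : MetricGroup} (x y z w : G.carrier) :
    dist (x * y) (z * w) ≤ dist x z + dist y w := by
  calc _ ≤ dist (x * y) (z * y) + dist (z * y) (z * w) := dist_triangle _ _ _
    _ = _ := by rw [G.dist_right_invariant, G.dist_left_invariant]

lemma lift_lipschitz {S : Type} [Fintype S] (G : MetricGroup) (w : FreeGroup S) :
    ∃ L : ℝ, ∀ φ ψ : S → G.carrier,
      dist (FreeGroup.lift φ w) (FreeGroup.lift ψ w) ≤ L * dist φ ψ := by
  induction w using FreeGroup.induction_on with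
  | C1 => exact ⟨0, by simp⟩
  | of s => exact ⟨1, fun φ ψ => by simpa using dist_le_pi_dist φ ψ s⟩
  | inv_of s _ =>
    exact ⟨1, fun φ ψ => by simpa [dist_inv_inv'] using dist_le_pi_dist φ ψ s⟩
  | mul x y hx hy =>
    obtain ⟨L, hL⟩ := hx
    obtain ⟨M, hM⟩ := hy
    refine ⟨L + M, fun φ ψ => ?_⟩
    rw [map_mul, map_mul]
    linarith [dist_mul_mul_le'' (FreeGroup.lift φ x) (FreeGroup.lift φ y)
      (FreeGroup.lift ψ x) (FreeGroup.lift ψ y), hL φ ψ, hM φ ψ]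

lemma homDist_le {S : Type} [Fintype S] (R : Finset (FreeGroup S)) {G : MetricGroup}
    (φ ψ : S → G.carrier) (h : ∀ r ∈ R, FreeGroup.lift ψ r = 1) :
    homDist R φ ≤ dist φ ψ := by
  have hle : Subgroup.normalClosure (R : Set (FreeGroup S)) ≤ (FreeGroup.lift ψ).ker :=
    Subgroup.normalClosure_le_normal (fun r hr => h r hr)
  have hb : BddBelow (Set.range fun π : (FreeGroup S ⧸
      Subgroup.normalClosure (R : Set (FreeGroup S))) →* G.carrier =>
      mapDist φ (fun s => π ((QuotientGroup.mk' _) (FreeGroup.of s)))) :=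
    ⟨0, by rintro _ ⟨π, rfl⟩; exact NNReal.coe_nonneg _⟩
  have h1 := ciInf_le hb (QuotientGroup.lift _ (FreeGroup.lift ψ) hle)
  refine h1.trans (le_of_eq ?_)
  rw [mapDist_eq_dist]
  congr 1
  funext s
  simp

lemma exists_of_homDist_lt {S : Type} [Fintype S] (R : Finset (FreeGroup S)) {G : MetricGroup}
    (φ : S → G.carrier) {a : ℝ} (h : homDist R φ < a) :
    ∃ ψ : S → G.carrier, dist φ ψ ≤ a ∧ defect R ψ = 0 := by
  obtain ⟨π, hπ⟩ := exists_lt_of_ciInf_lt h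
  refine ⟨_, hπ.le, defect_eq_zero R _ fun r hr => ?_⟩
  have : FreeGroup.lift (fun s => π ((QuotientGroup.mk' _) (FreeGroup.of s))) =
      π.comp (QuotientGroup.mk' (Subgroup.normalClosure (R : Set (FreeGroup S)))) := by
    ext s; simp
  rw [this, MonoidHom.comp_apply]
  have h2 : (QuotientGroup.mk' (Subgroup.normalClosure (R : Set (FreeGroup S)))) r = 1 :=
    (QuotientGroup.eq_one_iff r).2 (Subgroup.subset_normalClosure hr)
  rw [h2, map_one]

lemma uniform_step {S : Type} [Fintype S] (R : Finset (FreeGroup S))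
    (𝒞 : Set MetricGroup) (𝒰 : Ultrafilter ℕ) (h𝒰 : (𝒰 : Filter ℕ) ≤ Filter.cofinite)
    (H : DefectDiminishing 𝒰 𝒞 R) :
    ∃ n : ℕ, ∀ G ∈ 𝒞, ∀ φ : S → G.carrier, defect R φ < 1 / ((n : ℝ) + 1) →
      ∃ φ' : S → G.carrier, dist φ φ' ≤ n * defect R φ ∧ defect R φ' ≤ 1 / 2 * defect R φ := by
  by_contra! hc
  choose G hG φ hφ hbad using hc
  have hle : (𝒰 : Filter ℕ) ≤ Filter.atTop := Nat.cofinite_eq_atTop ▸ h𝒰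
  have hasy : IsAsymptoticHom 𝒰 R G φ :=
    squeeze_zero (fun n => defect_nonneg' R _) (fun n => (hφ n).le)
      (tendsto_one_div_add_atTop_nhds_zero_nat.mono_left hle)
  obtain ⟨φ', ⟨C, hC, hCU⟩, ε, hε0, hε, hd⟩ := H G hG φ hasy
  have h1 : ∀ᶠ n in (𝒰 : Filter ℕ), mapDist (φ n) (φ' n) ≤ C * defect R (φ n) := hCU
  have h2 : ∀ᶠ n in (𝒰 : Filter ℕ), ε n < 1 / 2 := hε.eventually_lt_const (by norm_num)
  have h3 : ∀ᶠ n : ℕ in (𝒰 : Filter ℕ), C ≤ n :=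
    hle (tendsto_natCast_atTop_atTop.eventually_ge_atTop C)
  obtain ⟨n, a, b, c⟩ := (h1.and (h2.and h3)).exists
  have hn := defect_nonneg' R (φ n)
  have := hbad n (φ' n) (a.trans (mul_le_mul_of_nonneg_right c hn))
  rw [hd n] at this
  nlinarith

lemma iterate_limit {S : Type} [Fintype S] (R : Finset (FreeGroup S))
    (G : MetricGroup) [CompleteSpace G.carrier] (K δ : ℝ) (hK : 0 ≤ K)
    (step : ∀ φ : S → G.carrier, defect R φ < δ →
      ∃ φ' : S → G.carrier, dist φ φ' ≤ K * defect R φ ∧ defect R φ' ≤ 1 / 2 * defect R φ)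
    (φ : S → G.carrier) (hφ : defect R φ < δ) : homDist R φ ≤ 2 * K * defect R φ := by
  choose! f hf1 hf2 using step
  let u : ℕ → S → G.carrier := fun n => f^[n] φ
  have hs : ∀ n, u (n + 1) = f (u n) := fun n => Function.iterate_succ_apply' f n φ
  have h0 := defect_nonneg' R φ
  have hu : ∀ n, defect R (u n) < δ ∧ defect R (u n) ≤ defect R φ * (1 / 2) ^ n := by
    intro n
    induction n with
    | zero => exact ⟨hφ, by simp [u]⟩
    | succ n ih =>
      have := hf2 _ ih.1
      have h1 := defect_nonneg' R (u n)
      rw [hs]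
      refine ⟨by linarith [ih.1], ?_⟩
      rw [pow_succ]
      linarith [ih.2]
  have hd : ∀ n, dist (u n) (u (n + 1)) ≤ (K * defect R φ) * (1 / 2) ^ n := by
    intro n
    rw [hs, mul_assoc]
    exact (hf1 _ (hu n).1).trans (mul_le_mul_of_nonneg_left (hu n).2 hK)
  obtain ⟨ψ, hψ⟩ := cauchySeq_tendsto_of_complete
    (cauchySeq_of_le_geometric _ _ (by norm_num) hd)
  have hdist := dist_le_of_le_geometric_of_tendsto₀ _ _ (by norm_num) hd hψ
  have hp : Filter.Tendsto (fun n : ℕ => defect R φ * (1 / 2 : ℝ) ^ n) Filter.atTop (nhds 0) := by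
    simpa using (tendsto_pow_atTop_nhds_zero_of_lt_one (r := (1 / 2 : ℝ))
      (by norm_num) (by norm_num)).const_mul (defect R φ)
  refine (homDist_le R φ ψ fun r hr => ?_).trans (hdist.trans (le_of_eq (by ring)))
  obtain ⟨L, hL⟩ := lift_lipschitz G r
  have ht : Filter.Tendsto (fun n => L * dist (u n) ψ + defect R φ * (1 / 2 : ℝ) ^ n)
      Filter.atTop (nhds 0) := by
    simpa using ((tendsto_iff_dist_tendsto_zero.1 hψ).const_mul L).add hp
  have : dist (FreeGroup.lift ψ r) 1 ≤ 0 := by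
    refine ge_of_tendsto' ht fun n => ?_
    have h1 := dist_triangle_left (FreeGroup.lift ψ r) 1 (FreeGroup.lift (u n) r)
    linarith [hL (u n) ψ, dist_le_defect R (u n) hr, (hu n).2]
  exact dist_le_zero.1 this

/-- Theorem (main): for a finitely presented group Γ = ⟨S | R⟩ and a class 𝒞 of groups
with bi-invariant complete metrics, Γ has defect diminishing iff D ⪯ id, i.e. iff there
are C > 0 and δ₀ > 0 with D(δ) ≤ C·id(C·δ) + C·δ = C·(C·δ) + C·δ for all δ ∈ (0, δ₀]. -/
theorem defect_diminishing_iff_D_precede_id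
    {S : Type} [Fintype S] (R : Finset (FreeGroup S))
    (𝒞 : Set MetricGroup) (hcomplete : ∀ G ∈ 𝒞, CompleteSpace G.carrier)
    (𝒰 : Ultrafilter ℕ) (h𝒰 : (𝒰 : Filter ℕ) ≤ Filter.cofinite) :
    DefectDiminishing 𝒰 𝒞 R ↔
      ∃ C : ℝ, 0 < C ∧ ∃ δ₀ : ℝ, 0 < δ₀ ∧ ∀ δ : ℝ, 0 < δ → δ ≤ δ₀ →
        Drate 𝒞 R δ ≤ ENNReal.ofReal (C * (C * δ) + C * δ) := by
  constructor
  · intro H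
    obtain ⟨N, hN⟩ := uniform_step R 𝒞 𝒰 h𝒰 H
    have hN0 : (0 : ℝ) ≤ N := Nat.cast_nonneg N
    refine ⟨2 * N + 1, by positivity, 1 / ((N : ℝ) + 1), by positivity, fun δ hδ hδ₀ => ?_⟩
    refine iSup_le fun G => iSup_le fun hG => iSup_le fun φ => iSup_le fun hφ => ?_
    apply ENNReal.ofReal_le_ofReal
    have := hcomplete G hG
    have h1 := iterate_limit R G N _ hN0 (hN G hG) φ (hφ.trans_le hδ₀)
    have h2 : 2 * (N : ℝ) * defect R φ ≤ 2 * N * δ :=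
      mul_le_mul_of_nonneg_left hφ.le (by positivity)
    have h3 : 0 ≤ (2 * (N : ℝ) + 1) * ((2 * N + 1) * δ) := by positivity
    linarith
  · rintro ⟨C, hC, δ₀, hδ₀, hD⟩ G hG φ hasy
    classical
    let K : ℝ := C * C + C
    have hK : 0 < K := by positivity
    let P : ∀ n, Prop := fun n => ∃ ψ : S → (G n).carrier,
      dist (φ n) ψ ≤ (K * 2) * defect R (φ n) ∧ defect R ψ = 0
    have hP : ∀ n, defect R (φ n) < δ₀ / 2 → P n := by
      intro n hn
      rcases (defect_nonneg' R (φ n)).eq_or_lt with h0 | h0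
      · exact ⟨φ n, by simp [← h0], h0.symm⟩
      · have key : ∀ δ, defect R (φ n) < δ → δ ≤ δ₀ → homDist R (φ n) ≤ K * δ := by
          intro δ h1 h2
          have hpos : 0 < δ := h0.trans h1
          have h3 : ENNReal.ofReal (homDist R (φ n)) ≤ Drate 𝒞 R δ :=
            le_iSup_of_le (G n) (le_iSup_of_le (hG n) (le_iSup_of_le (φ n)
              (le_iSup_of_le h1 le_rfl)))
          have h4 := (ENNReal.ofReal_le_ofReal_iff (by positivity)).1 (h3.trans (hD δ hpos h2))
          exact h4.trans (le_of_eq (by simp only [K]; ring))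
        have := key (3 / 2 * defect R (φ n)) (by linarith) (by linarith)
        exact exists_of_homDist_lt R (φ n) (this.trans_lt (by nlinarith [mul_pos hK h0]))
    refine ⟨fun n => if h : P n then h.choose else φ n, ⟨K * 2, by positivity, ?_⟩,
      fun n => if P n then 0 else 1, ?_, ?_, ?_⟩
    · refine Filter.mem_of_superset (hasy.eventually_lt_const (half_pos hδ₀)) fun n hn => ?_
      have h := hP n hn
      simp only [Set.mem_ofPred_eq, dif_pos h]
      exact h.choose_spec.1
    · intro n
      dsimp only
      split_ifs <;> norm_num
    · refine tendsto_const_nhds.congr' ?_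
      filter_upwards [hasy.eventually_lt_const (half_pos hδ₀)] with n hn
      rw [if_pos (hP n hn)]
    · intro n
      by_cases h : P n
      · simp only [dif_pos h, if_pos h, zero_mul]
        exact h.choose_spec.2
      · simp only [dif_neg h, if_neg h, one_mul]
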